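/- arXiv:1704.06891 — 2 statements merged into one kernel-verified Lean document; each statement's English description precedes it below -/
import Mathlib

section
/- Fix an integer p ≥ 2. For w₁, w₂ ∈ ℍ define θ₁(α; w₁, w₂) := Σ_{n∈α+ℤ²} (2n₁+n₂) n₂ e^{(3πi/2)(2n₁+n₂)² w₁ + (πi/2) n₂² w₂}. Then Σ_{α∈𝒮*} ε(α) θ₁(α; w₁, w₂) = (1/p²) Σ_{A∈𝒜} ε₁(A) Θ₁(2p, A₁, 2p; 3w₁/p) Θ₁(2p, A₂, 2p; w₂/p), where 𝒜 := {(0,2), (p,p+2), (p−1,p−1), (−1,−1), (p+1,p−1), (1,−1)} and ε₁(A) := −2 for A ∈ {(0,2), (p,p+2)} and ε₁(A) := 1 for the other elements of 𝒜. -/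
open Complex MeasureTheory Real Filter Topology

noncomputable section

/-- Shimura's theta function `Θ_ν(A,h,N;τ) = Σ_{m≡h (N)} m^ν e^{2πiτ·Am²/(2N²)}`. -/
def ShimTheta (ν : ℕ) (A : ℕ) (h : ℤ) (N : ℕ) (τ : ℂ) : ℂ :=
  ∑' m : ℤ, if (N : ℤ) ∣ (m - h) then
    (m : ℂ) ^ ν * Complex.exp (2 * Real.pi * Complex.I * τ * ((A : ℂ) * (m : ℂ) ^ 2 / (2 * (N : ℂ) ^ 2)))
  else 0

/-- `θ₁(α; w₁, w₂) = Σ_{n∈α+ℤ²} (2n₁+n₂)n₂ e^{(3πi/2)(2n₁+n₂)²w₁ + (πi/2)n₂²w₂}`. -/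
def theta1 (α : ℝ × ℝ) (w₁ w₂ : ℂ) : ℂ :=
  ∑' n : ℤ × ℤ,
    (((2 * (α.1 + n.1) + (α.2 + n.2)) * (α.2 + n.2) : ℝ) : ℂ) *
      Complex.exp ((3 * Real.pi * Complex.I / 2) * (((2 * (α.1 + n.1) + (α.2 + n.2)) ^ 2 : ℝ) : ℂ) * w₁
        + (Real.pi * Complex.I / 2) * ((((α.2 + n.2)) ^ 2 : ℝ) : ℂ) * w₂)

/-- The set `𝒮*`, listed in order. -/
def Sstar (p : ℕ) : Fin 3 → ℝ × ℝ :=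
  ![(1 - 1 / (p : ℝ), 2 / (p : ℝ)), (0, 1 - 1 / (p : ℝ)), (1 / (p : ℝ), 1 - 1 / (p : ℝ))]

/-- `ε` on `𝒮*`: `−2` on `(1−1/p, 2/p)`, `1` otherwise. -/
def epsStar : Fin 3 → ℝ := ![-2, 1, 1]

/-- The set `𝒜`, listed in order. -/
def Alist (p : ℕ) : Fin 6 → ℤ × ℤ :=
  ![(0, 2), ((p : ℤ), (p : ℤ) + 2), ((p : ℤ) - 1, (p : ℤ) - 1), (-1, -1),
    ((p : ℤ) + 1, (p : ℤ) - 1), (1, -1)]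

/-- `ε₁` on `𝒜`: `−2` on `(0,2)` and `(p,p+2)`, `1` otherwise. -/
def epsA : Fin 6 → ℝ := ![-2, -2, 1, 1, 1, 1]

/-- The terms of the series `Θ₁(2p, h, 2p; τ)`. -/
def shimTerm (p : ℕ) (τ : ℂ) (m : ℤ) : ℂ :=
  (m : ℂ) * Complex.exp (π * I * (τ / (2 * p)) * (m : ℂ) ^ 2)

lemma summable_shimTerm {p : ℕ} (hp : 0 < p) {τ : ℂ} (hτ : 0 < τ.im) :
    Summable (shimTerm p τ) := by
  have him : 0 < (τ / (2 * p)).im := by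
    rw [show τ / (2 * p) = τ / ((2 * p : ℝ) : ℂ) by push_cast; rfl, Complex.div_ofReal_im]
    positivity
  refine (((summable_jacobiTheta₂'_term_iff 0 _).mpr him).mul_left (2 * π * I)⁻¹).congr fun m ↦ ?_
  simp only [jacobiTheta₂'_term, jacobiTheta₂_term, shimTerm, mul_zero, zero_add]
  rw [mul_assoc (2 * π * I : ℂ), inv_mul_cancel_left₀ two_pi_I_ne_zero]
  ring_nf

lemma injective_add_two_mul_mul {p : ℕ} (hp : 0 < p) (h : ℤ) :
    Function.Injective fun j : ℤ ↦ h + 2 * p * j := by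
  intro i j hij
  have : (2 * p : ℤ) ≠ 0 := by positivity
  simpa [this, hp.ne'] using hij

lemma shimTheta_one_eq_tsum {p : ℕ} (hp : 0 < p) (h : ℤ) (τ : ℂ) :
    ShimTheta 1 (2 * p) h (2 * p) τ = ∑' j : ℤ, shimTerm p τ (h + 2 * p * j) := by
  have hp' : (p : ℂ) ≠ 0 := by exact_mod_cast hp.ne'
  rw [ShimTheta, ← (injective_add_two_mul_mul hp h).tsum_eq]
  · refine tsum_congr fun j ↦ ?_
    rw [if_pos ⟨j, by push_cast; ring⟩, pow_one, shimTerm]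
    congr 2
    push_cast
    field_simp
  · intro m hm
    obtain ⟨j, hj⟩ : ((2 * p : ℕ) : ℤ) ∣ m - h := by
      by_contra hdvd
      exact hm (if_neg hdvd)
    exact ⟨j, by push_cast at hj; simp only; linarith⟩

lemma shimTheta_congr (ν A : ℕ) {h h' : ℤ} {N : ℕ} (hh : (N : ℤ) ∣ h - h') (τ : ℂ) :
    ShimTheta ν A h N τ = ShimTheta ν A h' N τ := by
  refine tsum_congr fun m ↦ ?_
  have : (N : ℤ) ∣ m - h ↔ (N : ℤ) ∣ m - h' := by
    rw [show m - h' = (m - h) + (h - h') by ring]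
    exact (dvd_add_left hh).symm
  simp only [this]

/-- Splitting `ℤ²` by the parity of the second coordinate, after the change of variables
making `2k + l` depend on one coordinate only. -/
def parityEquiv : (ℤ × ℤ) ⊕ (ℤ × ℤ) ≃ ℤ × ℤ where
  toFun := Sum.elim (fun x ↦ (x.1 - x.2, 2 * x.2)) (fun x ↦ (x.1 - x.2, 2 * x.2 + 1))
  invFun x := if x.2 % 2 = 0 then .inl (x.1 + x.2 / 2, x.2 / 2) else .inr (x.1 + x.2 / 2, x.2 / 2)
  left_inv := by
    rintro (⟨j, m⟩ | ⟨j, m⟩)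
    · simp
    · have h1 : (2 * m + 1) % 2 = 1 := by omega
      have h2 : (2 * m + 1) / 2 = m := by omega
      simp [h1, h2]
  right_inv := by
    rintro ⟨k, l⟩
    by_cases h : l % 2 = 0
    · simp only [h, if_true, Sum.elim_inl, Prod.mk.injEq]
      omega
    · simp only [h, if_false, Sum.elim_inr, Prod.mk.injEq]
      omega

lemma hasSum_mul_tsum {ι κ : Type*} {u : ι → ℂ} {v : κ → ℂ} (hu : Summable u) (hv : Summable v) :
    HasSum (fun x : ι × κ ↦ u x.1 * v x.2) ((∑' i, u i) * ∑' k, v k) := by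
  have h := summable_mul_of_summable_norm hu.norm hv.norm
  rw [tsum_mul_tsum_of_summable_norm hu.norm hv.norm]
  exact h.hasSum

lemma tsum_lattice_eq {p : ℕ} (hp : 0 < p) {f g : ℤ → ℂ} (hf : Summable f) (hg : Summable g)
    (a b : ℤ) :
    ∑' n : ℤ × ℤ, f (a + p * (2 * n.1 + n.2)) * g (b + p * n.2) =
      (∑' j : ℤ, f (a + 2 * p * j)) * (∑' j : ℤ, g (b + 2 * p * j)) +
      (∑' j : ℤ, f (a + p + 2 * p * j)) * (∑' j : ℤ, g (b + p + 2 * p * j)) := by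
  have key (a b : ℤ) : HasSum (fun x : ℤ × ℤ ↦ f (a + 2 * p * x.1) * g (b + 2 * p * x.2))
      ((∑' j : ℤ, f (a + 2 * p * j)) * (∑' j : ℤ, g (b + 2 * p * j))) := by
    exact hasSum_mul_tsum (hf.comp_injective (injective_add_two_mul_mul hp a))
      (hg.comp_injective (injective_add_two_mul_mul hp b))
  refine HasSum.tsum_eq (parityEquiv.hasSum_iff.mp (HasSum.sum ?_ ?_))
  · convert key a b using 2 with x
    simp only [Function.comp_apply, parityEquiv, Equiv.coe_fn_mk, Sum.elim_inl]
    congr 2 <;> ring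
  · convert key (a + p) (b + p) using 2 with x
    simp only [Function.comp_apply, parityEquiv, Equiv.coe_fn_mk, Sum.elim_inr]
    congr 2 <;> ring

lemma theta1_eq_shimTheta {p : ℕ} (hp : 0 < p) {w₁ w₂ : ℂ} (h₁ : 0 < w₁.im) (h₂ : 0 < w₂.im)
    {α : ℝ × ℝ} {a b : ℤ} (ha : p * (2 * α.1 + α.2) = a) (hb : p * α.2 = b) :
    theta1 α w₁ w₂ = (1 / (p : ℂ) ^ 2) *
      (ShimTheta 1 (2 * p) a (2 * p) (3 * w₁ / p) * ShimTheta 1 (2 * p) b (2 * p) (w₂ / p) +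
        ShimTheta 1 (2 * p) (a + p) (2 * p) (3 * w₁ / p) *
          ShimTheta 1 (2 * p) (b + p) (2 * p) (w₂ / p)) := by
  have hpR : (p : ℝ) ≠ 0 := by exact_mod_cast hp.ne'
  have hpC : (p : ℂ) ≠ 0 := by exact_mod_cast hp.ne'
  have im₁ : 0 < (3 * w₁ / p).im := by
    rw [Complex.div_natCast_im, show (3 * w₁).im = 3 * w₁.im by simp]
    positivity
  have im₂ : 0 < (w₂ / p).im := by
    rw [Complex.div_natCast_im]
    positivity
  simp only [shimTheta_one_eq_tsum hp]
  rw [← tsum_lattice_eq hp (summable_shimTerm hp im₁) (summable_shimTerm hp im₂), ← tsum_mul_left,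
    theta1]
  refine tsum_congr fun ⟨k, l⟩ ↦ ?_
  have hX : 2 * (α.1 + k) + (α.2 + l) = ((a + p * (2 * k + l) : ℤ) : ℝ) / p := by
    push_cast
    rw [← ha]
    field_simp
    ring
  have hY : α.2 + l = ((b + p * l : ℤ) : ℝ) / p := by
    push_cast
    rw [← hb]
    field_simp
  simp only [hX]
  simp only [hY, shimTerm]
  generalize a + p * (2 * k + l) = X
  generalize b + p * l = Y
  rw [mul_mul_mul_comm, ← Complex.exp_add, ← mul_assoc]
  push_cast
  congr 1
  · field_simp
  · congr 1
    field_simp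

/-- Splitting of `Σ_{α∈𝒮*} ε(α)θ₁(α;·)` into products of Shimura theta functions. -/
theorem theta1_shimura_splitting (p : ℕ) (hp : 2 ≤ p) (w₁ w₂ : ℂ)
    (h₁ : 0 < w₁.im) (h₂ : 0 < w₂.im) :
    ∑ i : Fin 3, (epsStar i : ℂ) * theta1 (Sstar p i) w₁ w₂ =
      (1 / (p : ℂ) ^ 2) * ∑ i : Fin 6, (epsA i : ℂ) *
        ShimTheta 1 (2 * p) (Alist p i).1 (2 * p) (3 * w₁ / p) *
        ShimTheta 1 (2 * p) (Alist p i).2 (2 * p) (w₂ / p) := by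
  have hp0 : 0 < p := by omega
  have hpR : (p : ℝ) ≠ 0 := by exact_mod_cast hp0.ne'
  simp only [Fin.sum_univ_succ, Finset.univ_eq_empty, Finset.sum_empty]
  simp only [epsStar, epsA, Sstar, Alist, Matrix.cons_val]
  rw [theta1_eq_shimTheta hp0 h₁ h₂ (a := 2 * p) (b := 2)
      (by push_cast; field_simp; ring) (by push_cast; field_simp),
    theta1_eq_shimTheta hp0 h₁ h₂ (a := p - 1) (b := p - 1)
      (by push_cast; field_simp; ring) (by push_cast; field_simp),
    theta1_eq_shimTheta hp0 h₁ h₂ (a := p + 1) (b := p - 1)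
      (by push_cast; field_simp; ring) (by push_cast; field_simp)]
  have reduce (h h' : ℤ) (hh : h - h' = 2 * p) (τ : ℂ) :
      ShimTheta 1 (2 * p) h (2 * p) τ = ShimTheta 1 (2 * p) h' (2 * p) τ :=
    shimTheta_congr _ _ ⟨1, by push_cast; linarith⟩ τ
  rw [reduce (2 * p) 0 (by ring), reduce (2 * p + p) p (by ring),
    reduce (p - 1 + p) (-1) (by ring), reduce (p - 1 + p) (-1) (by ring),
    reduce (p + 1 + p) 1 (by ring), add_comm (2 : ℤ) p]
  push_cast
  ring

end
end

section
/- Let κ > 0 and u₁, u₂ ∈ ℝ with u₁ ≠ 0, u₂ ≠ 0, u₁ − κu₂ ≠ 0 and u₂ + κu₁ ≠ 0. Then M₂(κ; u₁, u₂) = −∫₁^∞ [ u₁ e^{−πu₁²w} M(u₂√w) + ((u₂ + κu₁)/√(1+κ²)) e^{−π(u₂+κu₁)²w/(1+κ²)} M(√w·(u₁ − κu₂)/√(1+κ²)) ] w^{−1/2} dw, the integral converging absolutely. -/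
open Complex MeasureTheory Real Filter Topology

noncomputable section

/-- `E(u) := 2∫₀ᵘ e^{−πw²} dw`. -/
def Efun (u : ℝ) : ℝ := 2 * ∫ w in (0:ℝ)..u, Real.exp (-Real.pi * w ^ 2)

/-- `M(u) := E(u) − sgn(u)`. -/
def Mfun (u : ℝ) : ℝ := Efun u - Real.sign u

/-- `E₂(κ; u₁, u₂) := ∫_{ℝ²} sgn(w₁) sgn(w₂ + κw₁) e^{−π((w₁−u₁)² + (w₂−u₂)²)} dw₁ dw₂`. -/
def E2 (κ u₁ u₂ : ℝ) : ℝ :=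
  ∫ w : ℝ × ℝ, Real.sign w.1 * Real.sign (w.2 + κ * w.1) *
    Real.exp (-Real.pi * ((w.1 - u₁) ^ 2 + (w.2 - u₂) ^ 2))

/-- `M₂(κ; u₁, u₂) := E₂(κ;u₁,u₂) − sgn(u₂)M(u₁) − sgn(u₁−κu₂)M((u₂+κu₁)/√(1+κ²))
 − sgn(u₁)sgn(u₂+κu₁)`. -/
def M2 (κ u₁ u₂ : ℝ) : ℝ :=
  E2 κ u₁ u₂ - Real.sign u₂ * Mfun u₁
    - Real.sign (u₁ - κ * u₂) * Mfun ((u₂ + κ * u₁) / Real.sqrt (1 + κ ^ 2))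
    - Real.sign u₁ * Real.sign (u₂ + κ * u₁)

lemma abs_sign_le_one (x : ℝ) : |Real.sign x| ≤ 1 := by
  rcases Real.sign_apply_eq x with h | h | h <;> simp [h]

lemma measurable_sign : Measurable Real.sign :=
  Measurable.ite measurableSet_Iio measurable_const
    (Measurable.ite measurableSet_Ioi measurable_const measurable_const)

lemma sign_pos_mul {a : ℝ} (ha : 0 < a) (x : ℝ) : Real.sign (a * x) = Real.sign x := by
  rcases lt_trichotomy x 0 with h | h | h
  · rw [Real.sign_of_neg h, Real.sign_of_neg (mul_neg_of_pos_of_neg ha h)]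
  · simp [h]
  · rw [Real.sign_of_pos h, Real.sign_of_pos (mul_pos ha h)]

/-- Along `t → ∞`, the sign of `c * t + s` is eventually the sign of the slope `c`. -/
lemma eventually_sign_eq {c : ℝ} (hc : c ≠ 0) (s : ℝ) :
    ∀ᶠ t : ℝ in atTop, Real.sign (c * t + s) = Real.sign c := by
  rcases hc.lt_or_gt with h | h
  · filter_upwards [(tendsto_atBot_add_const_right _ s
      (tendsto_id.const_mul_atTop_of_neg h)).eventually_lt_atBot 0] with t ht
    exact (Real.sign_of_neg ht).trans (Real.sign_of_neg h).symm
  · filter_upwards [(tendsto_atTop_add_const_right _ s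
      (tendsto_id.const_mul_atTop h)).eventually_gt_atTop 0] with t ht
    exact (Real.sign_of_pos ht).trans (Real.sign_of_pos h).symm

lemma hasDerivAt_Efun (u : ℝ) : HasDerivAt Efun (2 * Real.exp (-Real.pi * u ^ 2)) u :=
  ((Continuous.integral_hasStrictDerivAt (by fun_prop) 0 u).hasDerivAt).const_mul 2

lemma continuous_Efun : Continuous Efun :=
  continuous_iff_continuousAt.2 fun u => (hasDerivAt_Efun u).continuousAt

lemma Efun_neg (u : ℝ) : Efun (-u) = -Efun u := by
  have h := intervalIntegral.integral_comp_neg (a := 0) (b := u)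
    (fun w : ℝ => Real.exp (-Real.pi * w ^ 2))
  simp only [neg_sq, neg_zero] at h
  rw [Efun, Efun, h, intervalIntegral.integral_symm]
  ring

lemma tendsto_Efun_atTop : Tendsto Efun atTop (𝓝 1) := by
  have h := (intervalIntegral_tendsto_integral_Ioi 0
    (integrable_exp_neg_mul_sq Real.pi_pos).integrableOn tendsto_id).const_mul 2
  rw [integral_gaussian_Ioi, div_self Real.pi_ne_zero] at h
  rwa [Real.sqrt_one, mul_one_div, div_self two_ne_zero] at h

lemma tendsto_Efun_atBot : Tendsto Efun atBot (𝓝 (-1)) := by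
  have h := (tendsto_Efun_atTop.comp tendsto_neg_atBot_atTop).neg
  refine h.congr fun u => ?_
  simp [Efun_neg]

lemma abs_Efun_le_one (u : ℝ) : |Efun u| ≤ 1 := by
  have hmono : Monotone Efun := monotone_of_deriv_nonneg
    (fun u => (hasDerivAt_Efun u).differentiableAt)
    (fun u => by rw [(hasDerivAt_Efun u).deriv]; positivity)
  exact abs_le.2 ⟨hmono.le_of_tendsto tendsto_Efun_atBot u, hmono.ge_of_tendsto tendsto_Efun_atTop u⟩

lemma abs_Mfun_le_two (u : ℝ) : |Mfun u| ≤ 2 := by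
  have h1 := abs_Efun_le_one u
  have h2 := abs_sign_le_one u
  have h3 := abs_sub (Efun u) (Real.sign u)
  rw [Mfun]
  linarith

lemma tendsto_Efun_const_mul_add {c : ℝ} (hc : c ≠ 0) (s : ℝ) :
    Tendsto (fun t => Efun (c * t + s)) atTop (𝓝 (Real.sign c)) := by
  rcases hc.lt_or_gt with h | h
  · rw [Real.sign_of_neg h]
    exact tendsto_Efun_atBot.comp (tendsto_atBot_add_const_right _ s
      (tendsto_id.const_mul_atTop_of_neg h))
  · rw [Real.sign_of_pos h]
    exact tendsto_Efun_atTop.comp (tendsto_atTop_add_const_right _ s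
      (tendsto_id.const_mul_atTop h))

/-- The integral of a derivative against the sign function. -/
lemma integral_sign_mul_deriv {H H' : ℝ → ℝ} {a b : ℝ} (hd : ∀ x, HasDerivAt H (H' x) x)
    (hi : Integrable H') (hb : Tendsto H atBot (𝓝 a)) (ht : Tendsto H atTop (𝓝 b)) :
    ∫ w, Real.sign w * H' w = a + b - 2 * H 0 := by
  have hs : Integrable fun w => Real.sign w * H' w :=
    hi.bdd_mul (c := 1) measurable_sign.aestronglyMeasurable
      (ae_of_all _ fun w => abs_sign_le_one w)
  rw [← intervalIntegral.integral_Iic_add_Ioi hs.integrableOn hs.integrableOn (b := 0)]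
  have h1 : ∫ w in Set.Iic (0:ℝ), Real.sign w * H' w = -(H 0 - a) := by
    rw [integral_Iic_eq_integral_Iio, setIntegral_congr_fun (g := fun w => -H' w) measurableSet_Iio
      (fun w (hw : w < 0) => by simp [Real.sign_of_neg hw]), ← integral_Iic_eq_integral_Iio,
      integral_neg, integral_Iic_of_hasDerivAt_of_tendsto (hd 0).continuousAt.continuousWithinAt
        (fun x _ => hd x) hi.integrableOn hb]
  have h2 : ∫ w in Set.Ioi (0:ℝ), Real.sign w * H' w = b - H 0 := by
    rw [setIntegral_congr_fun (g := H') measurableSet_Ioi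
      (fun w (hw : 0 < w) => by simp [Real.sign_of_pos hw]),
      integral_Ioi_of_hasDerivAt_of_tendsto (hd 0).continuousAt.continuousWithinAt
        (fun x _ => hd x) hi.integrableOn ht]
  rw [h1, h2]
  ring

lemma integrable_gaussian_sub (q : ℝ) :
    Integrable fun w : ℝ => Real.exp (-Real.pi * (w - q) ^ 2) :=
  (integrable_exp_neg_mul_sq Real.pi_pos).comp_sub_right q

lemma integrable_mul_gaussian_sub (q : ℝ) :
    Integrable fun w : ℝ => (w - q) * Real.exp (-Real.pi * (w - q) ^ 2) :=
  (integrable_mul_exp_neg_mul_sq Real.pi_pos).comp_sub_right q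

lemma exp_neg_pi_mul_sq_le_one (x : ℝ) : Real.exp (-Real.pi * x ^ 2) ≤ 1 := by
  rw [Real.exp_le_one_iff]
  have := mul_nonneg Real.pi_pos.le (sq_nonneg x)
  linarith

lemma integrable_gaussian_mul_gaussian (κ p q : ℝ) :
    Integrable fun w : ℝ =>
      Real.exp (-Real.pi * (p + κ * w) ^ 2) * Real.exp (-Real.pi * (w - q) ^ 2) :=
  (integrable_gaussian_sub q).bdd_mul (c := 1)
    (Continuous.aestronglyMeasurable (by fun_prop))
    (ae_of_all _ fun w => by
      rw [Real.norm_eq_abs, abs_of_pos (Real.exp_pos _)]; exact exp_neg_pi_mul_sq_le_one _)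

/-- The integral of a product of two Gaussians against the sign function. -/
lemma integral_sign_mul_gaussian_mul_gaussian (κ p q : ℝ) :
    ∫ w, Real.sign w *
        (Real.exp (-Real.pi * (p + κ * w) ^ 2) * Real.exp (-Real.pi * (w - q) ^ 2)) =
      Real.exp (-Real.pi * (p + κ * q) ^ 2 / (1 + κ ^ 2)) *
        Efun ((q - κ * p) / √(1 + κ ^ 2)) / √(1 + κ ^ 2) := by
  have hpos : 0 < 1 + κ ^ 2 := by positivity
  set r := √(1 + κ ^ 2) with hr
  have hr0 : 0 < r := Real.sqrt_pos.2 hpos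
  have hr2 : 1 + κ ^ 2 = r ^ 2 := (Real.sq_sqrt hpos.le).symm
  set A := Real.exp (-Real.pi * (p + κ * q) ^ 2 / (1 + κ ^ 2)) with hA
  have hd : ∀ w, HasDerivAt (fun w => A / (2 * r) * Efun (r * w + -((q - κ * p) / r)))
      (Real.exp (-Real.pi * (p + κ * w) ^ 2) * Real.exp (-Real.pi * (w - q) ^ 2)) w := by
    intro w
    have h0 : HasDerivAt (fun w : ℝ => r * w + -((q - κ * p) / r)) r w := by
      simpa using ((hasDerivAt_id w).const_mul r).add_const (-((q - κ * p) / r))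
    have h1 := ((hasDerivAt_Efun (r * w + -((q - κ * p) / r))).comp w h0).const_mul (A / (2 * r))
    refine h1.congr_deriv ?_
    have h2 : A / (2 * r) * (2 * Real.exp (-Real.pi * (r * w + -((q - κ * p) / r)) ^ 2) * r)
        = A * Real.exp (-Real.pi * (r * w + -((q - κ * p) / r)) ^ 2) := by
      field_simp
    rw [h2, hA, ← Real.exp_add, ← Real.exp_add]
    congr 1
    have h3 : (p + κ * q) ^ 2 / r ^ 2 + (r * w + -((q - κ * p) / r)) ^ 2
        = (p + κ * w) ^ 2 + (w - q) ^ 2 := by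
      have : (p + κ * q) ^ 2 / r ^ 2 + (r * w + -((q - κ * p) / r)) ^ 2
          = r ^ 2 * w ^ 2 - 2 * w * (q - κ * p) + (1 + κ ^ 2) * (p ^ 2 + q ^ 2) / r ^ 2 := by
        field_simp
        ring
      rw [this, hr2, mul_div_cancel_left₀ _ (by positivity), ← hr2]
      ring
    rw [hr2, mul_div_assoc]
    linear_combination (-Real.pi) * h3
  have hb := (tendsto_Efun_atBot.comp (tendsto_atBot_add_const_right _ (-((q - κ * p) / r))
    (tendsto_id.const_mul_atBot hr0))).const_mul (A / (2 * r))
  have ht := (tendsto_Efun_atTop.comp (tendsto_atTop_add_const_right _ (-((q - κ * p) / r))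
    (tendsto_id.const_mul_atTop hr0))).const_mul (A / (2 * r))
  rw [integral_sign_mul_deriv hd (integrable_gaussian_mul_gaussian κ p q) hb ht]
  rw [mul_zero, zero_add, Efun_neg]
  field_simp
  ring

lemma integral_sign_mul_gaussian (u : ℝ) :
    ∫ w, Real.sign w * Real.exp (-Real.pi * (w - u) ^ 2) = Efun u := by
  simpa using integral_sign_mul_gaussian_mul_gaussian 0 0 u

lemma hasDerivAt_gaussian {f : ℝ → ℝ} {f' x : ℝ} (hf : HasDerivAt f f' x) :
    HasDerivAt (fun x => Real.exp (-Real.pi * f x ^ 2))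
      (-(2 * Real.pi * f x * f' * Real.exp (-Real.pi * f x ^ 2))) x := by
  refine ((hf.pow 2).const_mul (-Real.pi)).exp.congr_deriv ?_
  simp
  ring

lemma integrable_deriv_Efun_mul_gaussian (κ p q : ℝ) :
    Integrable fun w : ℝ =>
      2 * κ * (Real.exp (-Real.pi * (p + κ * w) ^ 2) * Real.exp (-Real.pi * (w - q) ^ 2)) -
        2 * Real.pi * (Efun (p + κ * w) * ((w - q) * Real.exp (-Real.pi * (w - q) ^ 2))) :=
  ((integrable_gaussian_mul_gaussian κ p q).const_mul _).sub
    (((integrable_mul_gaussian_sub q).bdd_mul (c := 1)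
      (continuous_Efun.comp (by fun_prop)).aestronglyMeasurable
      (ae_of_all _ fun w => abs_Efun_le_one _)).const_mul _)

/-- Integration by parts on both half-lines. -/
lemma integral_sign_mul_deriv_Efun_mul_gaussian (κ p q : ℝ) :
    ∫ w, Real.sign w *
      (2 * κ * (Real.exp (-Real.pi * (p + κ * w) ^ 2) * Real.exp (-Real.pi * (w - q) ^ 2)) -
        2 * Real.pi * (Efun (p + κ * w) * ((w - q) * Real.exp (-Real.pi * (w - q) ^ 2)))) =
      -2 * (Efun p * Real.exp (-Real.pi * q ^ 2)) := by
  have hd : ∀ w, HasDerivAt (fun w => Efun (p + κ * w) * Real.exp (-Real.pi * (w - q) ^ 2))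
      (2 * κ * (Real.exp (-Real.pi * (p + κ * w) ^ 2) * Real.exp (-Real.pi * (w - q) ^ 2)) -
        2 * Real.pi * (Efun (p + κ * w) * ((w - q) * Real.exp (-Real.pi * (w - q) ^ 2)))) w := by
    intro w
    have h0 : HasDerivAt (fun w : ℝ => p + κ * w) κ w := by
      simpa using ((hasDerivAt_id w).const_mul κ).const_add p
    refine (((hasDerivAt_Efun (p + κ * w)).comp w h0).mul
      (hasDerivAt_gaussian ((hasDerivAt_id w).sub_const q))).congr_deriv ?_
    simp
    ring
  have key : ∀ l : Filter ℝ, Tendsto (fun w : ℝ => (w - q) ^ 2) l atTop →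
      Tendsto (fun w => Efun (p + κ * w) * Real.exp (-Real.pi * (w - q) ^ 2)) l (𝓝 0) := by
    intro l hl
    refine bdd_le_mul_tendsto_zero' 1 (Eventually.of_forall fun w => abs_Efun_le_one _) ?_
    exact Real.tendsto_exp_atBot.comp
      (hl.const_mul_atTop_of_neg (neg_neg_of_pos Real.pi_pos))
  rw [integral_sign_mul_deriv hd (integrable_deriv_Efun_mul_gaussian κ p q)
    (key _ ?_) (key _ ?_)]
  · simp
  · refine ((tendsto_pow_atTop two_ne_zero).comp (tendsto_atTop_add_const_right _ q
      tendsto_neg_atBot_atTop)).congr fun w => ?_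
    simp only [Function.comp]
    ring
  · exact (tendsto_pow_atTop two_ne_zero).comp (tendsto_atTop_add_const_right _ (-q) tendsto_id)

/-- `E2` as a one-variable integral. -/
lemma E2_eq_integral (κ u₁ u₂ : ℝ) :
    E2 κ u₁ u₂ =
      ∫ w, Real.sign w * (Efun (u₂ + κ * w) * Real.exp (-Real.pi * (w - u₁) ^ 2)) := by
  have hint : Integrable (fun w : ℝ × ℝ => Real.sign w.1 * Real.sign (w.2 + κ * w.1) *
      Real.exp (-Real.pi * ((w.1 - u₁) ^ 2 + (w.2 - u₂) ^ 2))) (volume.prod volume) := by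
    have h := (integrable_gaussian_sub u₁).mul_prod (integrable_gaussian_sub u₂)
    refine Integrable.bdd_mul (c := 1) ?_ ?_ (ae_of_all _ fun w => ?_)
    · refine h.congr (ae_of_all _ fun w => ?_)
      simp only
      rw [← Real.exp_add]
      ring_nf
    · exact ((measurable_sign.comp measurable_fst).mul
        (measurable_sign.comp (by fun_prop))).aestronglyMeasurable
    · rw [norm_mul]
      exact mul_le_one₀ (abs_sign_le_one _) (norm_nonneg _) (abs_sign_le_one _)
  rw [E2, Measure.volume_eq_prod, integral_prod _ hint]
  refine integral_congr_ae (ae_of_all _ fun x => ?_)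
  simp only
  rw [← integral_sign_mul_gaussian, ← integral_mul_const, ← integral_const_mul,
    ← integral_sub_right_eq_self _ (κ * x)]
  refine integral_congr_ae (ae_of_all _ fun y => ?_)
  simp only
  rw [mul_add, Real.exp_add]
  ring_nf

lemma integrable_sign_mul_Efun_mul_gaussian (κ p q : ℝ) :
    Integrable fun w : ℝ =>
      Real.sign w * (Efun (p + κ * w) * Real.exp (-Real.pi * (w - q) ^ 2)) :=
  Integrable.bdd_mul (c := 1)
    ((integrable_gaussian_sub q).bdd_mul (c := 1)
      (continuous_Efun.comp (by fun_prop)).aestronglyMeasurable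
      (ae_of_all _ fun _ => abs_Efun_le_one _))
    measurable_sign.aestronglyMeasurable (ae_of_all _ fun w => abs_sign_le_one w)

lemma gaussian_sub_le {c C : ℝ} (hc : |c| ≤ C) (w : ℝ) :
    Real.exp (-Real.pi * (w - c) ^ 2) ≤
      Real.exp (Real.pi * C ^ 2) * Real.exp (-(Real.pi / 2) * w ^ 2) := by
  rw [← Real.exp_add, Real.exp_le_exp]
  have h1 : c ^ 2 ≤ C ^ 2 := sq_le_sq' (abs_le.1 hc).1 (abs_le.1 hc).2
  nlinarith [mul_nonneg Real.pi_pos.le (sq_nonneg (w - 2 * c)),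
    mul_le_mul_of_nonneg_left h1 Real.pi_pos.le]

/-- The derivative of `E2` along rays. -/
lemma hasDerivAt_E2_mul (κ u₁ u₂ t : ℝ) :
    HasDerivAt (fun t => E2 κ (t * u₁) (t * u₂))
      (2 * (u₁ * Real.exp (-Real.pi * (t * u₁) ^ 2) * Efun (t * u₂) +
        (u₂ + κ * u₁) / √(1 + κ ^ 2) *
          Real.exp (-Real.pi * (t * u₂ + κ * (t * u₁)) ^ 2 / (1 + κ ^ 2)) *
          Efun ((t * u₁ - κ * (t * u₂)) / √(1 + κ ^ 2)))) t := by
  simp only [E2_eq_integral]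
  set C := (|t| + 1) * |u₁| with hC
  have hball : ∀ x ∈ Metric.ball t 1, |x * u₁| ≤ C := by
    intro x hx
    rw [Metric.mem_ball, Real.dist_eq] at hx
    rw [abs_mul, hC]
    have := abs_sub_abs_le_abs_sub x t
    gcongr
    linarith
  let F' : ℝ → ℝ → ℝ := fun t w => Real.sign w *
    (2 * u₂ * (Real.exp (-Real.pi * (t * u₂ + κ * w) ^ 2) *
        Real.exp (-Real.pi * (w - t * u₁) ^ 2)) +
      2 * Real.pi * u₁ * (Efun (t * u₂ + κ * w) *
        ((w - t * u₁) * Real.exp (-Real.pi * (w - t * u₁) ^ 2))))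
  have hmeas : AEStronglyMeasurable (F' t) := by
    refine (measurable_sign.mul (Continuous.measurable ?_)).aestronglyMeasurable
    have := continuous_Efun
    fun_prop
  have hbound : ∀ w, ∀ x ∈ Metric.ball t 1, ‖F' x w‖ ≤
      (2 * |u₂| + 2 * Real.pi * |u₁| * (|w| + C)) *
        (Real.exp (Real.pi * C ^ 2) * Real.exp (-(Real.pi / 2) * w ^ 2)) := by
    intro w x hx
    have hc := hball x hx
    have hg := gaussian_sub_le hc w
    have h1 : |w - x * u₁| ≤ |w| + C := (abs_sub _ _).trans (by linarith)
    have h2 : ‖F' x w‖ ≤ 1 * (2 * |u₂| * (1 * Real.exp (-Real.pi * (w - x * u₁) ^ 2)) +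
        2 * Real.pi * |u₁| * (1 * ((|w| + C) * Real.exp (-Real.pi * (w - x * u₁) ^ 2)))) := by
      simp only [F', Real.norm_eq_abs]
      rw [abs_mul]
      refine mul_le_mul (abs_sign_le_one w) ?_ (abs_nonneg _) zero_le_one
      refine (abs_add_le _ _).trans (add_le_add ?_ ?_)
      · simp only [abs_mul, Real.abs_exp, abs_two]
        gcongr
        exact exp_neg_pi_mul_sq_le_one _
      · simp only [abs_mul, Real.abs_exp, abs_two, abs_of_pos Real.pi_pos]
        gcongr
        exact abs_Efun_le_one _
    calc ‖F' x w‖ ≤ _ := h2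
      _ = (2 * |u₂| + 2 * Real.pi * |u₁| * (|w| + C)) *
          Real.exp (-Real.pi * (w - x * u₁) ^ 2) := by ring
      _ ≤ _ := by gcongr
  have hbint : Integrable fun w : ℝ => (2 * |u₂| + 2 * Real.pi * |u₁| * (|w| + C)) *
        (Real.exp (Real.pi * C ^ 2) * Real.exp (-(Real.pi / 2) * w ^ 2)) := by
    have hp : 0 < Real.pi / 2 := by positivity
    have h1 := (integrable_exp_neg_mul_sq hp).const_mul
      ((2 * |u₂| + 2 * Real.pi * |u₁| * C) * Real.exp (Real.pi * C ^ 2))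
    have h2 := (integrable_mul_exp_neg_mul_sq hp).abs.const_mul
      (2 * Real.pi * |u₁| * Real.exp (Real.pi * C ^ 2))
    refine (h1.add h2).congr (ae_of_all _ fun w => ?_)
    simp only [Pi.add_apply, abs_mul, Real.abs_exp]
    ring
  have hderiv : ∀ w, ∀ x ∈ Metric.ball t 1, HasDerivAt (fun t => Real.sign w *
      (Efun (t * u₂ + κ * w) * Real.exp (-Real.pi * (w - t * u₁) ^ 2))) (F' x w) x := by
    intro w x _
    have h0 : HasDerivAt (fun t : ℝ => t * u₂ + κ * w) u₂ x := by
      simpa using ((hasDerivAt_id x).mul_const u₂).add_const (κ * w)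
    have h1 : HasDerivAt (fun t : ℝ => w - t * u₁) (-u₁) x := by
      simpa using ((hasDerivAt_id x).mul_const u₁).const_sub w
    refine ((((hasDerivAt_Efun _).comp x h0).mul (hasDerivAt_gaussian h1)).const_mul
      (Real.sign w)).congr_deriv ?_
    simp only [F', Function.comp]
    ring
  have hmain := (hasDerivAt_integral_of_dominated_loc_of_deriv_le
    (Metric.ball_mem_nhds t one_pos)
    (Eventually.of_forall fun x =>
      (integrable_sign_mul_Efun_mul_gaussian κ (x * u₂) (x * u₁)).aestronglyMeasurable)
    (integrable_sign_mul_Efun_mul_gaussian κ (t * u₂) (t * u₁)) hmeas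
    (ae_of_all _ hbound) hbint (ae_of_all _ hderiv)).2
  refine hmain.congr_deriv ?_
  have hsplit : ∀ w, F' t w =
      2 * (u₂ + κ * u₁) * (Real.sign w * (Real.exp (-Real.pi * (t * u₂ + κ * w) ^ 2) *
        Real.exp (-Real.pi * (w - t * u₁) ^ 2))) -
      u₁ * (Real.sign w * (2 * κ * (Real.exp (-Real.pi * (t * u₂ + κ * w) ^ 2) *
          Real.exp (-Real.pi * (w - t * u₁) ^ 2)) -
        2 * Real.pi * (Efun (t * u₂ + κ * w) *
          ((w - t * u₁) * Real.exp (-Real.pi * (w - t * u₁) ^ 2))))) := by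
    intro w
    simp only [F']
    ring
  have hsign : ∀ {f : ℝ → ℝ}, Integrable f → Integrable fun w => Real.sign w * f w := fun hf =>
    hf.bdd_mul (c := 1) measurable_sign.aestronglyMeasurable
      (ae_of_all _ fun w => abs_sign_le_one w)
  simp only [hsplit]
  rw [integral_sub ((hsign (integrable_gaussian_mul_gaussian _ _ _)).const_mul _)
    ((hsign (integrable_deriv_Efun_mul_gaussian _ _ _)).const_mul _),
    integral_const_mul, integral_const_mul, integral_sign_mul_gaussian_mul_gaussian,
    integral_sign_mul_deriv_Efun_mul_gaussian]
  ring

lemma tendsto_E2_mul (κ : ℝ) {u₁ u₂ : ℝ} (h₁ : u₁ ≠ 0) (h₄ : u₂ + κ * u₁ ≠ 0) :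
    Tendsto (fun t => E2 κ (t * u₁) (t * u₂)) atTop
      (𝓝 (Real.sign u₁ * Real.sign (u₂ + κ * u₁))) := by
  have hshift : ∀ t, E2 κ (t * u₁) (t * u₂) = ∫ s, Real.sign (u₁ * t + s) *
      (Efun ((u₂ + κ * u₁) * t + κ * s) * Real.exp (-Real.pi * s ^ 2)) := by
    intro t
    rw [E2_eq_integral, ← integral_add_right_eq_self _ (t * u₁)]
    refine integral_congr_ae (ae_of_all _ fun s => ?_)
    simp only
    ring_nf
  have hlim : ∫ s, Real.sign u₁ * (Real.sign (u₂ + κ * u₁) * Real.exp (-Real.pi * s ^ 2)) =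
      Real.sign u₁ * Real.sign (u₂ + κ * u₁) := by
    rw [integral_const_mul, integral_const_mul, integral_gaussian, div_self Real.pi_ne_zero]
    simp
  simp only [hshift]
  rw [← hlim]
  refine tendsto_integral_filter_of_dominated_convergence
    (fun s => Real.exp (-Real.pi * s ^ 2)) (Eventually.of_forall fun t => ?_)
    (Eventually.of_forall fun t => ae_of_all _ fun s => ?_)
    (integrable_exp_neg_mul_sq Real.pi_pos) (ae_of_all _ fun s => ?_)
  · refine ((measurable_sign.comp (by fun_prop)).mul
      (Continuous.measurable ?_)).aestronglyMeasurable
    have := continuous_Efun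
    fun_prop
  · rw [Real.norm_eq_abs, abs_mul, abs_mul, Real.abs_exp, ← mul_assoc]
    exact mul_le_of_le_one_left (Real.exp_pos _).le
      (mul_le_one₀ (abs_sign_le_one _) (abs_nonneg _) (abs_Efun_le_one _))
  · exact (tendsto_const_nhds.congr' ((eventually_sign_eq h₁ s).mono fun t ht => ht.symm)).mul
      ((tendsto_Efun_const_mul_add h₄ (κ * s)).mul_const _)

/-- The absolute convergence of the one-variable integrals of Gaussians against `Mfun`. -/
lemma integrableOn_exp_mul_Mfun_div_sqrt (a b : ℝ) {c : ℝ} (hc : 0 < c) :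
    IntegrableOn (fun w : ℝ => a * Real.exp (-c * w) * Mfun (b * √w) / √w) (Set.Ioi 1) := by
  have hm : Measurable Mfun := continuous_Efun.measurable.sub measurable_sign
  refine Integrable.mono' (((exp_neg_integrableOn_Ioi 1 hc).const_mul (|a| * 2)))
    (Measurable.aestronglyMeasurable (by fun_prop)) ?_
  filter_upwards [ae_restrict_mem measurableSet_Ioi] with w hw
  have hw1 : 1 ≤ √w := Real.one_le_sqrt.2 (le_of_lt hw)
  rw [Real.norm_eq_abs, abs_div, abs_mul, abs_mul, Real.abs_exp, abs_of_pos (by linarith : 0 < √w)]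
  refine (div_le_self (by positivity) hw1).trans ?_
  calc |a| * Real.exp (-c * w) * |Mfun (b * √w)| ≤ |a| * Real.exp (-c * w) * 2 := by
        gcongr
        exact abs_Mfun_le_two _
    _ = |a| * 2 * Real.exp (-c * w) := by ring

lemma Mfun_mul_sqrt (b : ℝ) {w : ℝ} (hw : 0 < w) :
    Mfun (b * √w) = Efun (√w * b) - Real.sign b := by
  rw [Mfun, mul_comm, sign_pos_mul (Real.sqrt_pos.2 hw)]

/-- The one-variable integral representation of `M₂` (equation (6.2) of the paper). -/
theorem M2_integral_representation (κ u₁ u₂ : ℝ) (hκ : 0 < κ)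
    (h₁ : u₁ ≠ 0) (h₂ : u₂ ≠ 0) (h₃ : u₁ - κ * u₂ ≠ 0) (h₄ : u₂ + κ * u₁ ≠ 0) :
    IntegrableOn (fun w : ℝ =>
        (u₁ * Real.exp (-Real.pi * u₁ ^ 2 * w) * Mfun (u₂ * Real.sqrt w)
          + (u₂ + κ * u₁) / Real.sqrt (1 + κ ^ 2) *
              Real.exp (-Real.pi * (u₂ + κ * u₁) ^ 2 * w / (1 + κ ^ 2)) *
              Mfun (Real.sqrt w * (u₁ - κ * u₂) / Real.sqrt (1 + κ ^ 2))) / Real.sqrt w)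
      (Set.Ioi (1:ℝ)) ∧
    M2 κ u₁ u₂ = -∫ w in Set.Ioi (1:ℝ),
        (u₁ * Real.exp (-Real.pi * u₁ ^ 2 * w) * Mfun (u₂ * Real.sqrt w)
          + (u₂ + κ * u₁) / Real.sqrt (1 + κ ^ 2) *
              Real.exp (-Real.pi * (u₂ + κ * u₁) ^ 2 * w / (1 + κ ^ 2)) *
              Mfun (Real.sqrt w * (u₁ - κ * u₂) / Real.sqrt (1 + κ ^ 2))) / Real.sqrt w := by
  have hpos : 0 < 1 + κ ^ 2 := by positivity
  set r := √(1 + κ ^ 2) with hr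
  have hr0 : 0 < r := Real.sqrt_pos.2 hpos
  have hr2 : r ^ 2 = 1 + κ ^ 2 := Real.sq_sqrt hpos.le
  have hint : IntegrableOn (fun w : ℝ =>
        (u₁ * Real.exp (-Real.pi * u₁ ^ 2 * w) * Mfun (u₂ * Real.sqrt w)
          + (u₂ + κ * u₁) / r *
              Real.exp (-Real.pi * (u₂ + κ * u₁) ^ 2 * w / (1 + κ ^ 2)) *
              Mfun (Real.sqrt w * (u₁ - κ * u₂) / r)) / Real.sqrt w)
      (Set.Ioi (1:ℝ)) := by
    have hc₁ : 0 < Real.pi * u₁ ^ 2 := by positivity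
    have hc₂ : 0 < Real.pi * (u₂ + κ * u₁) ^ 2 / (1 + κ ^ 2) := by positivity
    refine ((integrableOn_exp_mul_Mfun_div_sqrt u₁ u₂ hc₁).add
      (integrableOn_exp_mul_Mfun_div_sqrt ((u₂ + κ * u₁) / r) ((u₁ - κ * u₂) / r) hc₂)).congr
        (ae_of_all _ fun w => ?_)
    have e₁ : -(Real.pi * u₁ ^ 2) * w = -Real.pi * u₁ ^ 2 * w := by ring
    have e₂ : -(Real.pi * (u₂ + κ * u₁) ^ 2 / (1 + κ ^ 2)) * w =
      -Real.pi * (u₂ + κ * u₁) ^ 2 * w / (1 + κ ^ 2) := by ring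
    have e₃ : (u₁ - κ * u₂) / r * √w = √w * (u₁ - κ * u₂) / r := by ring
    simp only [Pi.add_apply]
    rw [e₁, e₂, e₃, ← add_div]
  refine ⟨hint, ?_⟩
  set v := (u₂ + κ * u₁) / r with hv
  have hv0 : v ≠ 0 := div_ne_zero h₄ hr0.ne'
  have hsv : Real.sign v = Real.sign (u₂ + κ * u₁) := by
    rw [hv, div_eq_inv_mul, sign_pos_mul (inv_pos.2 hr0)]
  have hsx : Real.sign ((u₁ - κ * u₂) / r) = Real.sign (u₁ - κ * u₂) := by
    rw [div_eq_inv_mul, sign_pos_mul (inv_pos.2 hr0)]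
  let g : ℝ → ℝ := fun t => E2 κ (t * u₁) (t * u₂)
    - Real.sign u₂ * (Efun (u₁ * t + 0) - Real.sign u₁)
    - Real.sign (u₁ - κ * u₂) * (Efun (v * t + 0) - Real.sign v)
    - Real.sign u₁ * Real.sign (u₂ + κ * u₁)
  have hg1 : g 1 = M2 κ u₁ u₂ := by
    simp only [g, M2, Mfun, one_mul, mul_one, add_zero]
    rfl
  have hglim : Tendsto g atTop (𝓝 0) := by
    have h := (((tendsto_E2_mul κ h₁ h₄).sub
      (((tendsto_Efun_const_mul_add h₁ 0).sub_const (Real.sign u₁)).const_mul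
        (Real.sign u₂))).sub
      (((tendsto_Efun_const_mul_add hv0 0).sub_const (Real.sign v)).const_mul
        (Real.sign (u₁ - κ * u₂)))).sub_const (Real.sign u₁ * Real.sign (u₂ + κ * u₁))
    simpa [g] using h
  have hE : ∀ c t : ℝ, HasDerivAt (fun t => Efun (c * t + 0))
      (2 * Real.exp (-Real.pi * (c * t) ^ 2) * c) t := by
    intro c t
    have h0 : HasDerivAt (fun t : ℝ => c * t + 0) c t := by
      simpa using (hasDerivAt_id t).const_mul c
    refine ((hasDerivAt_Efun (c * t + 0)).comp t h0).congr_deriv ?_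
    rw [add_zero]
  have hgd : ∀ t, HasDerivAt g
      (2 * (u₁ * Real.exp (-Real.pi * (u₁ * t) ^ 2) * (Efun (t * u₂) - Real.sign u₂) +
        v * Real.exp (-Real.pi * (v * t) ^ 2) *
          (Efun (t * ((u₁ - κ * u₂) / r)) - Real.sign (u₁ - κ * u₂)))) t := by
    intro t
    refine ((((hasDerivAt_E2_mul κ u₁ u₂ t).sub
      (((hE u₁ t).sub_const (Real.sign u₁)).const_mul (Real.sign u₂))).sub
      (((hE v t).sub_const (Real.sign v)).const_mul
        (Real.sign (u₁ - κ * u₂)))).sub_const _).congr_deriv ?_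
    have e₁ : -Real.pi * (t * u₂ + κ * (t * u₁)) ^ 2 / (1 + κ ^ 2) = -Real.pi * (v * t) ^ 2 := by
      rw [hv, ← hr2]
      field_simp
    have e₂ : (t * u₁ - κ * (t * u₂)) / r = t * ((u₁ - κ * u₂) / r) := by ring
    rw [← hr, ← hv, e₁, e₂, mul_comm t u₁]
    ring
  have hderiv : ∀ w ∈ Set.Ioi (1:ℝ), HasDerivAt (fun w => g √w)
      ((u₁ * Real.exp (-Real.pi * u₁ ^ 2 * w) * Mfun (u₂ * Real.sqrt w)
          + v * Real.exp (-Real.pi * (u₂ + κ * u₁) ^ 2 * w / (1 + κ ^ 2)) *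
              Mfun (Real.sqrt w * (u₁ - κ * u₂) / r)) / Real.sqrt w) w := by
    intro w hw
    have hw0 : 0 < w := zero_lt_one.trans hw
    refine ((hgd √w).comp w (Real.hasDerivAt_sqrt hw0.ne')).congr_deriv ?_
    have e₁ : -Real.pi * (u₁ * √w) ^ 2 = -Real.pi * u₁ ^ 2 * w := by
      rw [mul_pow, Real.sq_sqrt hw0.le]
      ring
    have e₂ : -Real.pi * (v * √w) ^ 2 = -Real.pi * (u₂ + κ * u₁) ^ 2 * w / (1 + κ ^ 2) := by
      rw [mul_pow, Real.sq_sqrt hw0.le, hv, div_pow, hr2]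
      ring
    have e₃ : √w * (u₁ - κ * u₂) / r = (u₁ - κ * u₂) / r * √w := by ring
    rw [e₁, e₂, e₃, Mfun_mul_sqrt _ hw0, Mfun_mul_sqrt _ hw0, hsx]
    have : √w ≠ 0 := (Real.sqrt_pos.2 hw0).ne'
    field_simp
  have hcont : Continuous g := continuous_iff_continuousAt.2 fun t => (hgd t).continuousAt
  rw [integral_Ioi_of_hasDerivAt_of_tendsto
    (hcont.comp Real.continuous_sqrt).continuousAt.continuousWithinAt hderiv hint
    (hglim.comp Real.tendsto_sqrt_atTop)]
  simp [hg1]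

end
end
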